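/- Let μ ≥ 0 with μ ≠ 1/4 and let d ≥ 1. Then there exists C > 0 such that for all t ≥ t₀ ≥ 0 and all ξ ∈ ℝ^d \ {0}: |E_0(t,t₀,ξ)| ≤ C (1 + |ξ|^{−1/2 − Re ν}) and |E_0(t,t₀,ξ)| ≤ C (1+t)^{1/2 + Re ν} (1+t₀)^{−1/2 − Re ν}; moreover |E_1(t,t₀,ξ)| ≤ C (|ξ|^{−1} + (1+t₀)^{1/2 − Re ν} |ξ|^{−1/2 − Re ν}) and |E_1(t,t₀,ξ)| ≤ C (1+t)^{1/2 + Re ν} (1+t₀)^{1/2 − Re ν}. -/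

import Mathlib

open MeasureTheory Real Set

noncomputable section

/-- Bessel function of the first kind `J_ν(τ)`, defined by its power series,
using the principal branch of `(τ/2)^(ν+2k)`. -/
def besselJ (ν : ℂ) (τ : ℝ) : ℂ :=
  ∑' k : ℕ, ((-1 : ℂ) ^ k / ((Nat.factorial k : ℂ) * Complex.Gamma (ν + k + 1))) *
    ((τ : ℂ) / 2) ^ (ν + 2 * (k : ℂ))

/-- Bessel function of the second kind (Neumann function) `Y_ν(τ)` for `ν ∉ ℤ`. -/
def besselY (ν : ℂ) (τ : ℝ) : ℂ :=
  (besselJ ν τ * Complex.cos (ν * (π : ℂ)) - besselJ (-ν) τ) / Complex.sin (ν * (π : ℂ))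

/-- The index `ν` associated with the mass parameter `μ`. -/
def nuOf (μ : ℝ) : ℂ :=
  if μ ≤ 1 / 4 then ((Real.sqrt (1 - 4 * μ) / 2 : ℝ) : ℂ)
  else Complex.I * ((Real.sqrt (4 * μ - 1) / 2 : ℝ) : ℂ)

/-- `e₊(t,ξ) = τ^{1/2} J_ν(τ)` with `τ = (1+t) r`, `r = |ξ|`. -/
def ePlus (ν : ℂ) (r t : ℝ) : ℂ :=
  (Real.sqrt ((1 + t) * r) : ℂ) * besselJ ν ((1 + t) * r)

/-- `e₋(t,ξ) = τ^{1/2} Y_ν(τ)` with `τ = (1+t) r`, `r = |ξ|`. -/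
def eMinus (ν : ℂ) (r t : ℝ) : ℂ :=
  (Real.sqrt ((1 + t) * r) : ℂ) * besselY ν ((1 + t) * r)

/-- `ė₊ = ∂ₜ e₊`. -/
def ePlusDot (ν : ℂ) (r t : ℝ) : ℂ := deriv (ePlus ν r) t

/-- `ė₋ = ∂ₜ e₋`. -/
def eMinusDot (ν : ℂ) (r t : ℝ) : ℂ := deriv (eMinus ν r) t

/-- The Fourier multiplier `E₀(t,t₀,ξ)` of the Klein–Gordon propagator. -/
def E0 (ν : ℂ) (r t t₀ : ℝ) : ℂ :=
  (ePlus ν r t * eMinusDot ν r t₀ - ePlusDot ν r t₀ * eMinus ν r t) /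
    (ePlus ν r t₀ * eMinusDot ν r t₀ - ePlusDot ν r t₀ * eMinus ν r t₀)

/-- The Fourier multiplier `E₁(t,t₀,ξ)` of the Klein–Gordon propagator. -/
def E1 (ν : ℂ) (r t t₀ : ℝ) : ℂ :=
  (ePlus ν r t₀ * eMinus ν r t - ePlus ν r t * eMinus ν r t₀) /
    (ePlus ν r t₀ * eMinusDot ν r t₀ - ePlusDot ν r t₀ * eMinus ν r t₀)

/-- `Ė₀ = ∂ₜ E₀` (derivative in the first time variable). -/
def E0dot (ν : ℂ) (r t t₀ : ℝ) : ℂ := deriv (fun s => E0 ν r s t₀) t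

/-- `Ė₁ = ∂ₜ E₁` (derivative in the first time variable). -/
def E1dot (ν : ℂ) (r t t₀ : ℝ) : ℂ := deriv (fun s => E1 ν r s t₀) t

/-- The Neumann function `Y₀(τ)` (logarithmic case `ν = 0`). -/
def besselY0 (τ : ℝ) : ℂ :=
  (2 / (π : ℂ)) * (Complex.log ((τ : ℂ) / 2) + (Real.eulerMascheroniConstant : ℂ)) * besselJ 0 τ +
    (2 / (π : ℂ)) * ∑' k : ℕ,
      ((-1 : ℂ) ^ ((k + 1) + 1) * ((harmonic (k + 1) : ℚ) : ℂ) /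
          ((Nat.factorial (k + 1) : ℂ)) ^ 2) * ((τ : ℂ) / 2) ^ (2 * (k + 1))

/-- `e₋(t,ξ) = τ^{1/2} Y₀(τ)` in the case `μ = 1/4`, `ν = 0`. -/
def eMinusZ (r t : ℝ) : ℂ :=
  (Real.sqrt ((1 + t) * r) : ℂ) * besselY0 ((1 + t) * r)

/-- `ė₋ = ∂ₜ e₋` in the case `μ = 1/4`. -/
def eMinusZDot (r t : ℝ) : ℂ := deriv (eMinusZ r) t

/-- `E₀(t,t₀,ξ)` in the case `μ = 1/4`, `ν = 0`. -/
def E0Z (r t t₀ : ℝ) : ℂ :=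
  (ePlus 0 r t * eMinusZDot r t₀ - ePlusDot 0 r t₀ * eMinusZ r t) /
    (ePlus 0 r t₀ * eMinusZDot r t₀ - ePlusDot 0 r t₀ * eMinusZ r t₀)

/-- `E₁(t,t₀,ξ)` in the case `μ = 1/4`, `ν = 0`. -/
def E1Z (r t t₀ : ℝ) : ℂ :=
  (ePlus 0 r t₀ * eMinusZ r t - ePlus 0 r t * eMinusZ r t₀) /
    (ePlus 0 r t₀ * eMinusZDot r t₀ - ePlusDot 0 r t₀ * eMinusZ r t₀)

/-- `Ė₀` in the case `μ = 1/4`. -/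
def E0Zdot (r t t₀ : ℝ) : ℂ := deriv (fun s => E0Z r s t₀) t

/-- `Ė₁` in the case `μ = 1/4`. -/
def E1Zdot (r t t₀ : ℝ) : ℂ := deriv (fun s => E1Z r s t₀) t

/-- `(v, v')` is a solution, together with its derivative, of
`v'' + (r² + m / s²) v = 0` on the half-line `s > 0`. -/
def IsKGSolution (m r : ℝ) (v v' : ℝ → ℂ) : Prop :=
  ∀ s : ℝ, 0 < s → HasDerivAt v (v' s) s ∧
    HasDerivAt v' (-((r ^ 2 + m / s ^ 2 : ℝ) : ℂ) * v s) s

lemma IsKGSolution.linear_comb {m r : ℝ} {v v' w w' : ℝ → ℂ} (hv : IsKGSolution m r v v')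
    (hw : IsKGSolution m r w w') (α β : ℂ) :
    IsKGSolution m r (fun s => α * v s + β * w s) (fun s => α * v' s + β * w' s) := by
  intro s hs
  refine ⟨((hv s hs).1.const_mul α).add ((hw s hs).1.const_mul β), ?_⟩
  exact (((hv s hs).2.const_mul α).fun_add ((hw s hs).2.const_mul β)).congr_deriv (by ring)

lemma inner_mul_self_eq (c z : ℂ) : inner ℝ z (c * z) = c.re * ‖z‖ ^ 2 := by
  rw [Complex.inner, ← Complex.normSq_eq_norm_sq, Complex.normSq_apply]
  simp
  ring

/-- The energy `‖v'‖² + (r² + m / s²) ‖v‖²` is nonincreasing. -/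
lemma IsKGSolution.energy_le {m r : ℝ} {v v' : ℝ → ℂ} (hm : 0 ≤ m) (h : IsKGSolution m r v v')
    {s₀ s : ℝ} (hs₀ : 0 < s₀) (hs : s₀ ≤ s) :
    ‖v' s‖ ^ 2 + (r ^ 2 + m / s ^ 2) * ‖v s‖ ^ 2 ≤
      ‖v' s₀‖ ^ 2 + (r ^ 2 + m / s₀ ^ 2) * ‖v s₀‖ ^ 2 := by
  have key : ∀ x : ℝ, 0 < x → HasDerivAt
      (fun s => ‖v' s‖ ^ 2 + (r ^ 2 + m / s ^ 2) * ‖v s‖ ^ 2)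
      (-(2 * m / x ^ 3) * ‖v x‖ ^ 2) x := by
    intro x hx
    have hx' := hx.ne'
    have h1 : HasDerivAt (fun s : ℝ => r ^ 2 + m / s ^ 2) (-(2 * m / x ^ 3)) x := by
      refine ((((hasDerivAt_pow 2 x).fun_inv (by positivity)).const_mul m).const_add
        (r ^ 2)).congr_deriv ?_
      norm_num
      field_simp
    refine ((h x hx).2.norm_sq.fun_add (h1.fun_mul (h x hx).1.norm_sq)).congr_deriv ?_
    have h2 : inner ℝ (v' x) (-((r ^ 2 + m / x ^ 2 : ℝ) : ℂ) * v x) =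
        -(r ^ 2 + m / x ^ 2) * inner ℝ (v x) (v' x) := by
      rw [← Complex.ofReal_neg, ← Complex.real_smul, inner_smul_right, real_inner_comm]
    rw [h2]
    ring
  have anti : AntitoneOn (fun s => ‖v' s‖ ^ 2 + (r ^ 2 + m / s ^ 2) * ‖v s‖ ^ 2) (Ioi 0) := by
    refine antitoneOn_of_hasDerivWithinAt_nonpos (convex_Ioi 0)
      (fun x hx => (key x hx).continuousAt.continuousWithinAt)
      (f' := fun x => -(2 * m / x ^ 3) * ‖v x‖ ^ 2) ?_ ?_
    · intro x hx
      rw [interior_Ioi] at hx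
      exact (key x hx).hasDerivWithinAt
    · intro x hx
      rw [interior_Ioi] at hx
      have hx0 : 0 < x := hx
      have : 0 ≤ 2 * m / x ^ 3 * ‖v x‖ ^ 2 := by positivity
      linarith
  exact anti (show s₀ ∈ Ioi 0 from hs₀) (show s ∈ Ioi 0 from hs₀.trans_le hs) hs

/-- Growth bound for the diagonalised first-order system at low frequency. -/
lemma IsKGSolution.diagonal_le {m r : ℝ} {v v' : ℝ → ℂ} (h : IsKGSolution m r v v')
    {a b : ℂ} (hab : a + b = 1) (hm : a * b = (m : ℂ)) (hne : a ≠ b) (hre : b.re ≤ a.re)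
    {s₀ s : ℝ} (hs₀ : 0 < s₀) (hs : s₀ ≤ s) (hr : r ^ 2 * s ^ 2 ≤ 1) :
    ‖s * v' s - b * v s‖ ^ 2 + ‖s * v' s - a * v s‖ ^ 2 ≤
      Real.exp (2 / ‖a - b‖) * (s / s₀) ^ (2 * a.re) *
        (‖s₀ * v' s₀ - b * v s₀‖ ^ 2 + ‖s₀ * v' s₀ - a * v s₀‖ ^ 2) := by
  set A : ℝ → ℂ := fun s => s * v' s - b * v s with hA
  set B : ℝ → ℂ := fun s => s * v' s - a * v s with hB
  have hδ : 0 < ‖a - b‖ := norm_pos_iff.2 (sub_ne_zero.2 hne)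
  set δ := ‖a - b‖ with hδd
  set p := a.re with hp
  have dA : ∀ x : ℝ, 0 < x → ∀ c c' : ℂ, c + c' = 1 → c * c' = m →
      HasDerivAt (fun s : ℝ => (s : ℂ) * v' s - c' * v s)
        ((c / x) * ((x : ℂ) * v' x - c' * v x) - ((r ^ 2 * x : ℝ) : ℂ) * v x) x := by
    intro x hx c c' hcc hcm
    have hx' : (x : ℂ) ≠ 0 := Complex.ofReal_ne_zero.2 hx.ne'
    refine ((Complex.ofRealCLM.hasDerivAt (x := x)).fun_mul (h x hx).2).fun_sub
      ((h x hx).1.const_mul c') |>.congr_deriv ?_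
    simp only [Complex.ofRealCLM_apply, Complex.ofReal_one]
    push_cast
    rw [← hcm, ← hcc]
    have : c = 1 - c' := by rw [← hcc]; ring
    subst this
    field_simp
    ring
  set H : ℝ → ℝ := fun x => (‖A x‖ ^ 2 + ‖B x‖ ^ 2) *
    (x ^ (-(2 * p)) * Real.exp (-(2 / δ * (r ^ 2 * x ^ 2)))) with hH
  have key : ∀ x : ℝ, 0 < x → ∃ y ≤ 0, HasDerivAt H y x := by
    intro x hx
    have d1 := (dA x hx a b hab hm).norm_sq
    have d2 := (dA x hx b a (by rw [add_comm, hab]) (by rw [mul_comm, hm])).norm_sq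
    have d3 : HasDerivAt (fun x : ℝ => x ^ (-(2 * p)))
        (-(2 * p) * (x ^ (-(2 * p)) / x)) x := by
      refine (Real.hasDerivAt_rpow_const (p := -(2 * p)) (Or.inl hx.ne')).congr_deriv ?_
      rw [Real.rpow_sub_one hx.ne']
    have d4 : HasDerivAt (fun x : ℝ => Real.exp (-(2 / δ * (r ^ 2 * x ^ 2))))
        (Real.exp (-(2 / δ * (r ^ 2 * x ^ 2))) * (-(4 / δ * (r ^ 2 * x)))) x := by
      refine ((((hasDerivAt_pow 2 x).const_mul (r ^ 2)).const_mul (2 / δ)).fun_neg).exp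
        |>.congr_deriv ?_
      norm_num
      ring
    refine ⟨_, ?_, (d1.add d2).mul (d3.mul d4)⟩
    have i1 : inner ℝ (A x) ((a / x) * A x - ((r ^ 2 * x : ℝ) : ℂ) * v x) ≤
        p / x * ‖A x‖ ^ 2 + r ^ 2 * x * (‖A x‖ * ‖v x‖) := by
      rw [inner_sub_right, inner_mul_self_eq, Complex.div_ofReal_re, ← Complex.real_smul,
        inner_smul_right]
      have := neg_le_of_abs_le (abs_real_inner_le_norm (A x) (v x))
      have hq : 0 ≤ r ^ 2 * x := by positivity
      nlinarith [mul_le_mul_of_nonneg_left this hq]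
    have i2 : inner ℝ (B x) ((b / x) * B x - ((r ^ 2 * x : ℝ) : ℂ) * v x) ≤
        p / x * ‖B x‖ ^ 2 + r ^ 2 * x * (‖B x‖ * ‖v x‖) := by
      rw [inner_sub_right, inner_mul_self_eq, Complex.div_ofReal_re, ← Complex.real_smul,
        inner_smul_right]
      have := neg_le_of_abs_le (abs_real_inner_le_norm (B x) (v x))
      have hq : 0 ≤ r ^ 2 * x := by positivity
      have h3 : b.re / x * ‖B x‖ ^ 2 ≤ p / x * ‖B x‖ ^ 2 := by gcongr
      nlinarith [mul_le_mul_of_nonneg_left this hq]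
    have hv : δ * ‖v x‖ ≤ ‖A x‖ + ‖B x‖ := by
      rw [hδd, ← norm_mul, show (a - b) * v x = A x - B x by simp only [hA, hB]; ring]
      exact norm_sub_le _ _
    have hv' : (‖A x‖ + ‖B x‖) * ‖v x‖ ≤ 2 / δ * (‖A x‖ ^ 2 + ‖B x‖ ^ 2) := by
      rw [div_mul_eq_mul_div, le_div_iff₀ hδ]
      nlinarith [mul_le_mul_of_nonneg_left hv (by positivity : 0 ≤ ‖A x‖ + ‖B x‖),
        sq_nonneg (‖A x‖ - ‖B x‖)]
    have hv'' := mul_le_mul_of_nonneg_left hv' (by positivity : 0 ≤ 2 * (r ^ 2 * x))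
    set X := x ^ (-(2 * p)) with hX
    set Y := Real.exp (-(2 / δ * (r ^ 2 * x ^ 2))) with hY
    have hXY : 0 ≤ X * Y := by positivity
    have hfin : 2 * inner ℝ (A x) ((a / x) * A x - ((r ^ 2 * x : ℝ) : ℂ) * v x) +
        2 * inner ℝ (B x) ((b / x) * B x - ((r ^ 2 * x : ℝ) : ℂ) * v x) -
        (2 * p / x + 4 / δ * (r ^ 2 * x)) * (‖A x‖ ^ 2 + ‖B x‖ ^ 2) ≤ 0 := by
      have e1 : 2 * p / x = 2 * (p / x) := by ring
      have e2 : 4 / δ = 2 * (2 / δ) := by ring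
      rw [e1, e2]
      linarith
    refine le_of_eq_of_le ?_ (mul_nonpos_of_nonneg_of_nonpos hXY hfin)
    simp only [hA, hB, Pi.add_apply]
    ring
  have anti : AntitoneOn H (Ioi 0) := by
    refine antitoneOn_of_deriv_nonpos (convex_Ioi 0) ?_ ?_ ?_
    · intro x hx
      obtain ⟨y, -, hy⟩ := key x hx
      exact hy.continuousAt.continuousWithinAt
    · intro x hx
      rw [interior_Ioi] at hx
      obtain ⟨y, -, hy⟩ := key x hx
      exact hy.differentiableAt.differentiableWithinAt
    · intro x hx
      rw [interior_Ioi] at hx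
      obtain ⟨y, hy0, hy⟩ := key x hx
      rwa [hy.deriv]
  have hspos := hs₀.trans_le hs
  have hle : H s ≤ H s₀ := anti (show s₀ ∈ Ioi 0 from hs₀) (show s ∈ Ioi 0 from hspos) hs
  simp only [hH] at hle
  have hexp : Real.exp (-(2 / δ)) ≤ Real.exp (-(2 / δ * (r ^ 2 * s ^ 2))) := by
    apply Real.exp_le_exp.2
    have : 2 / δ * (r ^ 2 * s ^ 2) ≤ 2 / δ * 1 := by gcongr
    linarith
  have hexp₀ : Real.exp (-(2 / δ * (r ^ 2 * s₀ ^ 2))) ≤ 1 := by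
    rw [Real.exp_le_one_iff]
    have : 0 ≤ 2 / δ * (r ^ 2 * s₀ ^ 2) := by positivity
    linarith
  set G := ‖A s‖ ^ 2 + ‖B s‖ ^ 2 with hG
  set G₀ := ‖A s₀‖ ^ 2 + ‖B s₀‖ ^ 2 with hG₀
  have hGn : 0 ≤ G := by positivity
  have hG₀n : 0 ≤ G₀ := by positivity
  have hX : 0 < s ^ (2 * p) := Real.rpow_pos_of_pos hspos _
  have hX₀ : 0 < s₀ ^ (2 * p) := Real.rpow_pos_of_pos hs₀ _
  rw [Real.rpow_neg hspos.le, Real.rpow_neg hs₀.le] at hle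
  have step : G * ((s ^ (2 * p))⁻¹ * Real.exp (-(2 / δ))) ≤ G₀ * ((s₀ ^ (2 * p))⁻¹ * 1) :=
    calc _ ≤ G * ((s ^ (2 * p))⁻¹ * Real.exp (-(2 / δ * (r ^ 2 * s ^ 2)))) := by gcongr
      _ ≤ _ := hle
      _ ≤ _ := by gcongr
  rw [Real.exp_neg] at step
  rw [Real.div_rpow hspos.le hs₀.le]
  have hE := Real.exp_pos (2 / δ)
  change G ≤ Real.exp (2 / δ) * (s ^ (2 * p) / s₀ ^ (2 * p)) * G₀
  calc G = (G * ((s ^ (2 * p))⁻¹ * (Real.exp (2 / δ))⁻¹)) *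
        (s ^ (2 * p) * Real.exp (2 / δ)) := by field_simp
    _ ≤ (G₀ * ((s₀ ^ (2 * p))⁻¹ * 1)) * (s ^ (2 * p) * Real.exp (2 / δ)) := by gcongr
    _ = _ := by field_simp

/-- Low-frequency bounds for a solution and its derivative. -/
lemma exists_lowFreq_bound (m : ℝ) {a b : ℂ} (hab : a + b = 1)
    (hm : a * b = (m : ℂ)) (hne : a ≠ b) (hre : b.re ≤ a.re) :
    ∃ K > (0 : ℝ), ∀ (r : ℝ) (v v' : ℝ → ℂ), IsKGSolution m r v v' →
      ∀ s₀ s : ℝ, 0 < s₀ → s₀ ≤ s → r ^ 2 * s ^ 2 ≤ 1 →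
        ‖v s‖ ≤ K * (s / s₀) ^ a.re * (‖v s₀‖ + s₀ * ‖v' s₀‖) ∧
        s * ‖v' s‖ ≤ K * (s / s₀) ^ a.re * (‖v s₀‖ + s₀ * ‖v' s₀‖) := by
  have hδ : 0 < ‖a - b‖ := norm_pos_iff.2 (sub_ne_zero.2 hne)
  set δ := ‖a - b‖ with hδd
  set M : ℝ := Real.exp (1 / δ) * ((1 + ‖a‖) + (1 + ‖b‖)) with hM
  have hMpos : 0 < M := by positivity
  refine ⟨2 * M / δ + (M + ‖b‖ * (2 * M / δ)), by positivity, ?_⟩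
  intro r v v' h s₀ s hs₀ hs hr
  have hspos := hs₀.trans_le hs
  set N := ‖v s₀‖ + s₀ * ‖v' s₀‖ with hN
  have hNn : 0 ≤ N := by positivity
  set q := (s / s₀) ^ a.re with hq
  have hqn : 0 < q := Real.rpow_pos_of_pos (by positivity) _
  have hq2 : (s / s₀) ^ (2 * a.re) = q ^ 2 := by
    rw [hq, ← Real.rpow_natCast, ← Real.rpow_mul (by positivity)]
    congr 1
    push_cast
    ring
  have hinit : ∀ c : ℂ, ‖s₀ * v' s₀ - c * v s₀‖ ≤ (1 + ‖c‖) * N := by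
    intro c
    refine (norm_sub_le _ _).trans ?_
    rw [norm_mul, norm_mul, Complex.norm_real, Real.norm_of_nonneg hs₀.le]
    have := norm_nonneg c
    have h1 := norm_nonneg (v s₀)
    have h2 : 0 ≤ s₀ * ‖v' s₀‖ := by positivity
    rw [hN]
    nlinarith [mul_nonneg this h2]
  have hG := h.diagonal_le hab hm hne hre hs₀ hs hr
  have hG' : ‖s * v' s - b * v s‖ ^ 2 + ‖s * v' s - a * v s‖ ^ 2 ≤ (M * q * N) ^ 2 := by
    refine hG.trans ?_
    rw [hq2]
    have e : Real.exp (2 / δ) = Real.exp (1 / δ) ^ 2 := by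
      rw [← Real.exp_nat_mul]; congr 1; push_cast; ring
    have hb2 := pow_le_pow_left₀ (norm_nonneg _) (hinit b) 2
    have ha2 := pow_le_pow_left₀ (norm_nonneg _) (hinit a) 2
    rw [e]
    calc _ ≤ Real.exp (1 / δ) ^ 2 * q ^ 2 * (((1 + ‖b‖) * N) ^ 2 + ((1 + ‖a‖) * N) ^ 2) := by
          gcongr
      _ = (Real.exp (1 / δ) * q * N) ^ 2 * ((1 + ‖b‖) ^ 2 + (1 + ‖a‖) ^ 2) := by ring
      _ ≤ (Real.exp (1 / δ) * q * N) ^ 2 * ((1 + ‖a‖) + (1 + ‖b‖)) ^ 2 := by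
          gcongr
          nlinarith [norm_nonneg a, norm_nonneg b, mul_nonneg (norm_nonneg a) (norm_nonneg b)]
      _ = _ := by rw [hM]; ring
  have hA : ‖s * v' s - b * v s‖ ≤ M * q * N :=
    le_of_sq_le_sq (by nlinarith [sq_nonneg ‖s * v' s - a * v s‖]) (by positivity)
  have hB : ‖s * v' s - a * v s‖ ≤ M * q * N :=
    le_of_sq_le_sq (by nlinarith [sq_nonneg ‖s * v' s - b * v s‖]) (by positivity)
  have hv : ‖v s‖ ≤ 2 * M / δ * q * N := by
    have h1 : δ * ‖v s‖ ≤ 2 * (M * q * N) := by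
      rw [hδd, ← norm_mul,
        show (a - b) * v s = (s * v' s - b * v s) - (s * v' s - a * v s) by ring]
      refine (norm_sub_le _ _).trans (by linarith)
    rw [show 2 * M / δ * q * N = 2 * (M * q * N) / δ by ring, le_div_iff₀ hδ]
    linarith
  have hqN : 0 ≤ q * N := by positivity
  constructor
  · have : 0 ≤ (M + ‖b‖ * (2 * M / δ)) * q * N := by positivity
    linarith
  · have h1 : s * ‖v' s‖ = ‖(s * v' s - b * v s) + b * v s‖ := by
      rw [sub_add_cancel, norm_mul, Complex.norm_real, Real.norm_of_nonneg hspos.le]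
    have h2 : s * ‖v' s‖ ≤ M * q * N + ‖b‖ * (2 * M / δ * q * N) := by
      rw [h1]
      refine (norm_add_le _ _).trans ?_
      rw [norm_mul]
      gcongr
    have : 0 ≤ 2 * M / δ * q * N := by positivity
    linarith

/-- Uniform bounds for solutions in the low- and high-frequency regimes of the initial time. -/
lemma exists_uniform_bound {m : ℝ} (hm0 : 0 ≤ m) {a b : ℂ} (hab : a + b = 1)
    (hm : a * b = (m : ℂ)) (hne : a ≠ b) (hre : b.re ≤ a.re) :
    ∃ C > (0 : ℝ), ∀ (r : ℝ) (v v' : ℝ → ℂ), 0 < r → IsKGSolution m r v v' →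
      ∀ s₀ s : ℝ, 0 < s₀ → s₀ ≤ s →
        (1 ≤ r * s₀ → ‖v s‖ ≤ C * (‖v s₀‖ + r⁻¹ * ‖v' s₀‖)) ∧
        (r * s₀ ≤ 1 → ‖v s‖ ≤ C * (min s r⁻¹ / s₀) ^ a.re * (‖v s₀‖ + s₀ * ‖v' s₀‖)) := by
  obtain ⟨K, hK, hlow⟩ := exists_lowFreq_bound m hab hm hne hre
  have high : ∀ (r : ℝ) (v v' : ℝ → ℂ), 0 < r → IsKGSolution m r v v' →
      ∀ s₀ s : ℝ, 0 < s₀ → s₀ ≤ s → 1 ≤ r * s₀ →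
        ‖v s‖ ≤ (1 + m) * (‖v s₀‖ + r⁻¹ * ‖v' s₀‖) := by
    intro r v v' hr h s₀ s hs₀ hs hrs
    have hE := h.energy_le hm0 hs₀ hs
    have h1 : m / s₀ ^ 2 ≤ m * r ^ 2 := by
      rw [div_le_iff₀ (by positivity)]
      nlinarith [mul_le_mul_of_nonneg_left (one_le_pow₀ hrs (n := 2)) hm0]
    have h2 : 0 ≤ m / s ^ 2 * ‖v s‖ ^ 2 := by positivity
    have h3 : (m / s₀ ^ 2) * ‖v s₀‖ ^ 2 ≤ m * r ^ 2 * ‖v s₀‖ ^ 2 := by gcongr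
    have h4 : (r * ‖v s‖) ^ 2 ≤ ((1 + m) * (r * ‖v s₀‖ + ‖v' s₀‖)) ^ 2 := by
      have hx : 0 ≤ r * ‖v s₀‖ := by positivity
      have hy : 0 ≤ ‖v' s₀‖ := by positivity
      have h5 : (r * ‖v s‖) ^ 2 ≤ ‖v' s₀‖ ^ 2 + (1 + m) * (r * ‖v s₀‖) ^ 2 := by
        have h6 : 0 ≤ ‖v' s‖ ^ 2 := by positivity
        linarith
      refine h5.trans ?_
      have h6 : (1 : ℝ) ≤ 1 + m := by linarith
      have h7 : 1 + m ≤ (1 + m) ^ 2 := by nlinarith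
      calc _ ≤ (1 + m) ^ 2 * ‖v' s₀‖ ^ 2 + (1 + m) ^ 2 * (r * ‖v s₀‖) ^ 2 := by
            gcongr
            nlinarith [sq_nonneg ‖v' s₀‖]
        _ ≤ _ := by nlinarith [mul_nonneg (sq_nonneg (1 + m)) (mul_nonneg hx hy)]
    have h5 := le_of_sq_le_sq h4 (by positivity)
    calc ‖v s‖ = r⁻¹ * (r * ‖v s‖) := by field_simp
      _ ≤ r⁻¹ * ((1 + m) * (r * ‖v s₀‖ + ‖v' s₀‖)) := by gcongr
      _ = _ := by field_simp
  refine ⟨(1 + m) * (2 * K) + K + (1 + m), by positivity, ?_⟩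
  intro r v v' hr h s₀ s hs₀ hs
  have hspos := hs₀.trans_le hs
  refine ⟨fun hrs => ?_, fun hrs => ?_⟩
  · refine (high r v v' hr h s₀ s hs₀ hs hrs).trans ?_
    have : 0 ≤ (1 + m) * (2 * K) + K := by positivity
    refine mul_le_mul_of_nonneg_right (by linarith) (by positivity)
  · have hm1 : 0 ≤ (1 + m) * (2 * K) := by positivity
    have hri : r * r⁻¹ = 1 := mul_inv_cancel₀ hr.ne'
    have hs₁ : s₀ ≤ r⁻¹ := by
      rw [le_inv_comm₀ hs₀ hr, ← one_div, le_div_iff₀ hs₀]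
      exact hrs
    set N := ‖v s₀‖ + s₀ * ‖v' s₀‖ with hN
    have hNn : 0 ≤ N := by positivity
    rcases le_total s r⁻¹ with hle | hle
    · rw [min_eq_left hle]
      have h1 : r ^ 2 * s ^ 2 ≤ 1 := by
        rw [← mul_pow]
        refine pow_le_one₀ (by positivity) ?_
        rw [← hri]
        gcongr
      refine (hlow r v v' h s₀ s hs₀ hs h1).1.trans ?_
      gcongr
      linarith
    · rw [min_eq_right hle]
      have h1 : r ^ 2 * r⁻¹ ^ 2 ≤ 1 := by rw [← mul_pow, hri]; norm_num
      obtain ⟨k1, k2⟩ := hlow r v v' h s₀ r⁻¹ hs₀ hs₁ h1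
      refine (high r v v' hr h r⁻¹ s (by positivity) hle hri.ge).trans ?_
      have h2 : 0 ≤ (r⁻¹ / s₀) ^ a.re * N := by positivity
      calc _ ≤ (1 + m) * (K * (r⁻¹ / s₀) ^ a.re * N + K * (r⁻¹ / s₀) ^ a.re * N) := by gcongr
        _ = (1 + m) * (2 * K) * ((r⁻¹ / s₀) ^ a.re * N) := by ring
        _ ≤ ((1 + m) * (2 * K) + K + (1 + m)) * ((r⁻¹ / s₀) ^ a.re * N) := by
          gcongr
          linarith
        _ = _ := by ring

lemma summable_norm_deriv_coeff {c : ℕ → ℂ} (hc : ∀ R : ℝ, Summable fun k => ‖c k‖ * R ^ k)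
    (R : ℝ) : Summable fun k : ℕ => ‖((k : ℂ) + 1) * c (k + 1)‖ * R ^ k := by
  have h1 := (summable_nat_add_iff 1).2 (hc (2 * (|R| + 1)))
  refine Summable.of_norm_bounded h1 fun k => ?_
  have h2 : (k : ℝ) + 1 ≤ (2 : ℝ) ^ (k + 1) := by
    exact_mod_cast (Nat.lt_two_pow_self (n := k + 1)).le
  have h3 : |R| ^ k ≤ (|R| + 1) ^ (k + 1) := by
    have h0 := abs_nonneg R
    calc |R| ^ k ≤ (|R| + 1) ^ k := by gcongr; linarith
      _ ≤ _ := pow_le_pow_right₀ (by linarith) (Nat.le_succ k)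
  have h4 : ‖(k : ℂ) + 1‖ = (k : ℝ) + 1 := by
    rw [← Nat.cast_succ, Complex.norm_natCast, Nat.cast_succ]
  rw [norm_mul, norm_norm, norm_pow, Real.norm_eq_abs, norm_mul, h4, mul_pow]
  calc ((k : ℝ) + 1) * ‖c (k + 1)‖ * |R| ^ k
      ≤ 2 ^ (k + 1) * ‖c (k + 1)‖ * (|R| + 1) ^ (k + 1) := by gcongr
    _ = _ := by ring

lemma summable_power_series {c : ℕ → ℂ} (hc : ∀ R : ℝ, Summable fun k => ‖c k‖ * R ^ k)
    (z : ℂ) : Summable fun k => c k * z ^ k :=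
  Summable.of_norm (by simpa [norm_mul, norm_pow] using hc ‖z‖)

lemma hasDerivAt_power_series {c : ℕ → ℂ} (hc : ∀ R : ℝ, Summable fun k => ‖c k‖ * R ^ k)
    (z : ℂ) : HasDerivAt (fun z => ∑' k, c k * z ^ k)
      (∑' k : ℕ, (((k : ℂ) + 1) * c (k + 1)) * z ^ k) z := by
  have hu := summable_norm_deriv_coeff hc (‖z‖ + 1)
  have hu' : Summable fun k : ℕ => (k : ℝ) * ‖c k‖ * (‖z‖ + 1) ^ (k - 1) := by
    rw [← summable_nat_add_iff 1]
    refine hu.congr fun k => ?_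
    rw [norm_mul, ← Nat.cast_succ, Complex.norm_natCast]
    simp
  have hz : z ∈ Metric.ball (0 : ℂ) (‖z‖ + 1) := by simp
  have main := hasDerivAt_tsum_of_isPreconnected (g := fun k z => c k * z ^ k)
    (g' := fun k z => c k * (k * z ^ (k - 1))) hu' Metric.isOpen_ball
    (convex_ball (0 : ℂ) (‖z‖ + 1)).isPreconnected
    (fun k y _ => (hasDerivAt_pow k y).const_mul (c k))
    (fun k y hy => by
      have : ‖y‖ ≤ ‖z‖ + 1 := by simpa using (Metric.mem_ball.1 hy).le
      rw [norm_mul, norm_mul, norm_pow, Complex.norm_natCast]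
      calc ‖c k‖ * (k * ‖y‖ ^ (k - 1)) ≤ ‖c k‖ * (k * (‖z‖ + 1) ^ (k - 1)) := by gcongr
        _ = _ := by ring) hz (summable_power_series hc z) hz
  refine main.congr_deriv ?_
  rw [tsum_eq_zero_add']
  · simp
    congr 1
    ext k
    ring
  · have := summable_power_series (summable_norm_deriv_coeff hc) z
    refine this.congr fun k => ?_
    simp
    ring

/-- Coefficients of the entire function `g` with `J_ν(τ) = (τ/2)^ν g(τ²/4)`. -/
def besselCoeff (ν : ℂ) (k : ℕ) : ℂ :=
  (-1 : ℂ) ^ k / ((Nat.factorial k : ℂ) * Complex.Gamma (ν + k + 1))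

lemma re_add_natCast_add_one_pos {ν : ℂ} (hν : -1 < ν.re) (k : ℕ) : (k : ℝ) < (ν + k + 1).re := by
  simp
  linarith

lemma add_natCast_add_one_ne_zero {ν : ℂ} (hν : -1 < ν.re) (k : ℕ) : ν + k + 1 ≠ 0 := by
  intro h
  have h1 := re_add_natCast_add_one_pos hν k
  rw [h, Complex.zero_re] at h1
  exact absurd h1 (not_lt.2 k.cast_nonneg)

lemma besselCoeff_succ {ν : ℂ} (hν : -1 < ν.re) (k : ℕ) :
    ((k : ℂ) + 1) * (ν + k + 1) * besselCoeff ν (k + 1) = -besselCoeff ν k := by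
  have h1 := add_natCast_add_one_ne_zero hν k
  have h2 : (k : ℂ) + 1 ≠ 0 := Nat.cast_add_one_ne_zero k
  have h3 : (Nat.factorial k : ℂ) ≠ 0 := Nat.cast_ne_zero.2 (Nat.factorial_ne_zero k)
  have h4 : Complex.Gamma (ν + k + 1) ≠ 0 :=
    Complex.Gamma_ne_zero_of_re_pos
      (lt_of_le_of_lt k.cast_nonneg (re_add_natCast_add_one_pos hν k))
  unfold besselCoeff
  rw [Nat.factorial_succ, pow_succ]
  push_cast
  rw [← add_assoc ν (k : ℂ) 1, Complex.Gamma_add_one _ h1]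
  field_simp

lemma summable_besselCoeff {ν : ℂ} (hν : -1 < ν.re) (R : ℝ) :
    Summable fun k => ‖besselCoeff ν k‖ * R ^ k := by
  refine summable_of_ratio_norm_eventually_le (r := 1 / 2) (by norm_num) ?_
  filter_upwards [Filter.eventually_ge_atTop (⌈2 * |R|⌉₊ + 1)] with k hk
  have hkR : 2 * |R| ≤ k :=
    (Nat.le_ceil _).trans (by exact_mod_cast (Nat.le_succ _).trans hk)
  have hk1 : (1 : ℝ) ≤ k := by exact_mod_cast (Nat.le_add_left 1 _).trans hk
  have h1 := congrArg norm (besselCoeff_succ hν k)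
  rw [norm_neg, norm_mul, norm_mul, ← Nat.cast_succ, Complex.norm_natCast] at h1
  have h2 : (k : ℝ) ≤ ‖ν + k + 1‖ :=
    (re_add_natCast_add_one_pos hν k).le.trans (Complex.re_le_norm _)
  have h3 : 2 * |R| ≤ (k.succ : ℝ) * ‖ν + k + 1‖ := by
    push_cast
    nlinarith [abs_nonneg R]
  rw [norm_mul, norm_mul, norm_norm, norm_norm, norm_pow, norm_pow, Real.norm_eq_abs, ← h1, pow_succ]
  have h4 : 0 ≤ ‖besselCoeff ν (k + 1)‖ * |R| ^ k := by positivity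
  nlinarith [mul_le_mul_of_nonneg_right h3 h4]

/-- The entire function `g` with `J_ν(τ) = (τ/2)^ν g(τ²/4)`. -/
def besselEntire (ν : ℂ) (z : ℂ) : ℂ := ∑' k, besselCoeff ν k * z ^ k

lemma exists_besselEntire_deriv {ν : ℂ} (hν : -1 < ν.re) :
    ∃ g₁ g₂ : ℂ → ℂ, ∀ z, HasDerivAt (besselEntire ν) (g₁ z) z ∧ HasDerivAt g₁ (g₂ z) z ∧
      z * g₂ z + (ν + 1) * g₁ z + besselEntire ν z = 0 := by
  have s0 := summable_besselCoeff hν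
  have s1 := summable_norm_deriv_coeff s0
  have s2 := summable_norm_deriv_coeff s1
  refine ⟨_, _, fun z => ⟨hasDerivAt_power_series s0 z, hasDerivAt_power_series s1 z, ?_⟩⟩
  have t0 := summable_power_series s0 z
  have t1 := summable_power_series s1 z
  have t2 := (summable_power_series s2 z).mul_left z
  rw [besselEntire, t0.tsum_eq_zero_add, t1.tsum_eq_zero_add, ← tsum_mul_left]
  have u0 := (summable_nat_add_iff 1).2 t0
  have u1 := ((summable_nat_add_iff 1).2 t1).mul_left (ν + 1)
  rw [mul_add, ← tsum_mul_left]
  have hc0 := besselCoeff_succ hν 0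
  have e : (∑' k : ℕ, z * (((k : ℂ) + 1) * (((k + 1 : ℕ) : ℂ) + 1) *
        besselCoeff ν (k + 1 + 1) * z ^ k)) +
      (∑' k : ℕ, (ν + 1) * ((((k + 1 : ℕ) : ℂ) + 1) * besselCoeff ν (k + 1 + 1) * z ^ (k + 1))) +
      ∑' k : ℕ, besselCoeff ν (k + 1) * z ^ (k + 1) = 0 := by
    rw [← Summable.tsum_add _ u1, ← Summable.tsum_add _ u0]
    · convert tsum_zero with k
      have := besselCoeff_succ hν (k + 1)
      rw [← neg_eq_iff_eq_neg] at this
      rw [← this]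
      push_cast
      ring
    · refine Summable.add ?_ u1
      exact t2.congr fun k => by ring
    · exact t2.congr fun k => by ring
  simp only [Nat.cast_zero, zero_add, add_zero, one_mul, pow_zero, mul_one] at hc0 ⊢
  simp only [← mul_assoc] at e ⊢
  linear_combination e + hc0

lemma besselJ_eq {ν : ℂ} {τ : ℝ} (hτ : 0 < τ) :
    besselJ ν τ = ((τ : ℂ) / 2) ^ ν * besselEntire ν ((τ : ℂ) ^ 2 / 4) := by
  have h0 : (τ : ℂ) / 2 ≠ 0 := by
    simpa using hτ.ne'
  unfold besselJ besselEntire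
  rw [← tsum_mul_left]
  congr 1
  ext k
  rw [Complex.cpow_add _ _ h0, besselCoeff]
  have : ((τ : ℂ) / 2) ^ (2 * (k : ℂ)) = ((τ : ℂ) ^ 2 / 4) ^ k := by
    rw [show (2 * (k : ℂ)) = ((2 * k : ℕ) : ℂ) by push_cast; ring, Complex.cpow_natCast, pow_mul]
    congr 1
    ring
  rw [this]
  ring

lemma sqrt_mul_besselJ_eq {ν : ℂ} {τ : ℝ} (hτ : 0 < τ) :
    (Real.sqrt τ : ℂ) * besselJ ν τ =
      (2 : ℂ)⁻¹ ^ ν * ((τ : ℂ) ^ (1 / 2 + ν) * besselEntire ν ((τ : ℂ) ^ 2 / 4)) := by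
  have h0 : (τ : ℂ) ≠ 0 := by simpa using hτ.ne'
  have h1 : (Real.sqrt τ : ℂ) = (τ : ℂ) ^ (1 / 2 : ℂ) := by
    rw [Real.sqrt_eq_rpow, Complex.ofReal_cpow hτ.le]
    norm_num
  have h2 : ((τ : ℂ) / 2) ^ ν = (τ : ℂ) ^ ν * (2 : ℂ)⁻¹ ^ ν := by
    have := Complex.mul_cpow_ofReal_nonneg hτ.le (by norm_num : (0 : ℝ) ≤ 2⁻¹) ν
    rw [div_eq_mul_inv]
    simpa using this
  rw [besselJ_eq hτ, h1, h2, Complex.cpow_add _ _ h0]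
  ring

lemma hasDerivAt_ofReal_cpow_const_of_pos {x : ℝ} (hx : 0 < x) (a : ℂ) :
    HasDerivAt (fun y : ℝ => (y : ℂ) ^ a) (a * (x : ℂ) ^ a / x) x := by
  rcases eq_or_ne a 0 with rfl | ha
  · simpa using hasDerivAt_const x (1 : ℂ)
  · refine (hasDerivAt_ofReal_cpow_const hx.ne' ha).congr_deriv ?_
    rw [Complex.cpow_sub _ _ (Complex.ofReal_ne_zero.2 hx.ne'), Complex.cpow_one]
    ring

lemma IsKGSolution.congr {m r : ℝ} {v w v' : ℝ → ℂ} (h : IsKGSolution m r v v')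
    (hvw : ∀ s, 0 < s → w s = v s) : IsKGSolution m r w v' := by
  intro s hs
  refine ⟨(h s hs).1.congr_of_eventuallyEq ?_, ?_⟩
  · filter_upwards [Ioi_mem_nhds hs] with x hx using hvw x hx
  · rw [hvw s hs]
    exact (h s hs).2

/-- `τ^{1/2} J_ν(τ)` solves `f'' + (1 + m / τ²) f = 0` with `m = 1/4 - ν²`. -/
lemma exists_isKGSolution_sqrt_mul_besselJ {ν : ℂ} {m : ℝ} (hν : -1 < ν.re)
    (hm : (1 / 2 + ν) * (1 / 2 - ν) = (m : ℂ)) :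
    ∃ f', IsKGSolution m 1 (fun τ => (Real.sqrt τ : ℂ) * besselJ ν τ) f' := by
  obtain ⟨g₁, g₂, hg⟩ := exists_besselEntire_deriv hν
  refine ⟨fun τ => (2 : ℂ)⁻¹ ^ ν * ((1 / 2 + ν) * (τ : ℂ) ^ (1 / 2 + ν) / τ *
    besselEntire ν ((τ : ℂ) ^ 2 / 4) +
    (τ : ℂ) ^ (1 / 2 + ν) * (τ / 2 * g₁ ((τ : ℂ) ^ 2 / 4))), IsKGSolution.congr ?_
      (fun s hs => sqrt_mul_besselJ_eq hs)⟩
  intro s hs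
  have hs' : (s : ℂ) ≠ 0 := Complex.ofReal_ne_zero.2 hs.ne'
  have hid : HasDerivAt (fun y : ℝ => (y : ℂ)) 1 s := Complex.ofRealCLM.hasDerivAt
  have hsq : HasDerivAt (fun y : ℝ => ((y : ℂ) ^ 2 / 4 : ℂ)) (s / 2 : ℂ) s := by
    refine ((hid.fun_pow 2).div_const 4).congr_deriv ?_
    norm_num
    ring
  have hp := hasDerivAt_ofReal_cpow_const_of_pos hs (1 / 2 + ν)
  obtain ⟨d0, d1, hode⟩ := hg ((s : ℂ) ^ 2 / 4)
  have hg0 : HasDerivAt (fun y : ℝ => besselEntire ν ((y : ℂ) ^ 2 / 4))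
      (s / 2 * g₁ ((s : ℂ) ^ 2 / 4)) s :=
    HasDerivAt.scomp (h := fun y : ℝ => ((y : ℂ) ^ 2 / 4 : ℂ)) s d0 hsq
  have hg1 : HasDerivAt (fun y : ℝ => g₁ ((y : ℂ) ^ 2 / 4))
      (s / 2 * g₂ ((s : ℂ) ^ 2 / 4)) s :=
    HasDerivAt.scomp (h := fun y : ℝ => ((y : ℂ) ^ 2 / 4 : ℂ)) s d1 hsq
  refine ⟨(hp.fun_mul hg0).const_mul _, ?_⟩
  refine ((((hp.const_mul (1 / 2 + ν)).fun_div hid hs').fun_mul hg0).fun_add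
    (hp.fun_mul ((hid.div_const 2).fun_mul hg1)) |>.const_mul _).congr_deriv ?_
  push_cast
  rw [← hm]
  generalize (2 : ℂ)⁻¹ ^ ν = κ
  field_simp
  generalize (s : ℂ) ^ ((1 + 2 * ν) / 2) = P at *
  generalize besselEntire ν ((s : ℂ) ^ 2 / 4) = G at *
  generalize g₁ ((s : ℂ) ^ 2 / 4) = G1 at *
  generalize g₂ ((s : ℂ) ^ 2 / 4) = G2 at *
  linear_combination 4 * κ * P * s ^ 2 * hode

lemma IsKGSolution.comp_mul {m r : ℝ} {f f' : ℝ → ℂ} (hr : 0 < r) (h : IsKGSolution m 1 f f') :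
    IsKGSolution m r (fun s => f (s * r)) (fun s => (r : ℂ) * f' (s * r)) := by
  intro s hs
  obtain ⟨h0, h1⟩ := h (s * r) (by positivity)
  have hlin : HasDerivAt (fun s : ℝ => s * r) r s := by
    simpa using (hasDerivAt_id s).mul_const r
  constructor
  · exact (h0.scomp s hlin).congr_deriv (Complex.real_smul ..)
  · refine ((h1.scomp s hlin).const_mul (r : ℂ)).congr_deriv ?_
    have hs' : (s : ℂ) ≠ 0 := Complex.ofReal_ne_zero.2 hs.ne'
    have hr' : (r : ℂ) ≠ 0 := Complex.ofReal_ne_zero.2 hr.ne'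
    rw [Complex.real_smul]
    push_cast
    field_simp

lemma nuOf_re_nonneg (μ : ℝ) : 0 ≤ (nuOf μ).re := by
  unfold nuOf
  split_ifs
  · rw [Complex.ofReal_re]; positivity
  · simp

lemma nuOf_re_le {μ : ℝ} (hμ : 0 ≤ μ) : (nuOf μ).re ≤ 1 / 2 := by
  unfold nuOf
  split_ifs
  · rw [Complex.ofReal_re]
    have : Real.sqrt (1 - 4 * μ) ≤ 1 := Real.sqrt_le_one.2 (by linarith)
    linarith
  · simp

lemma nuOf_ne_zero {μ : ℝ} (hμ : μ ≠ 1 / 4) : nuOf μ ≠ 0 := by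
  unfold nuOf
  split_ifs with h
  · have h' : μ < 1 / 4 := lt_of_le_of_ne h hμ
    have : 0 < Real.sqrt (1 - 4 * μ) := Real.sqrt_pos.2 (by linarith)
    exact Complex.ofReal_ne_zero.2 (by positivity)
  · have h' : 1 / 4 < μ := not_le.1 h
    have : 0 < Real.sqrt (4 * μ - 1) := Real.sqrt_pos.2 (by linarith)
    exact mul_ne_zero Complex.I_ne_zero (Complex.ofReal_ne_zero.2 (by positivity))

lemma nuOf_mul_eq (μ : ℝ) : (1 / 2 + nuOf μ) * (1 / 2 - nuOf μ) = (μ : ℂ) := by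
  unfold nuOf
  split_ifs with h
  · have h1 : Real.sqrt (1 - 4 * μ) ^ 2 = 1 - 4 * μ := Real.sq_sqrt (by linarith)
    have h2 : ((Real.sqrt (1 - 4 * μ) : ℝ) : ℂ) ^ 2 = 1 - 4 * μ := by exact_mod_cast h1
    push_cast
    linear_combination (-1 / 4) * h2
  · have h1 : Real.sqrt (4 * μ - 1) ^ 2 = 4 * μ - 1 := Real.sq_sqrt (by linarith)
    have h2 : ((Real.sqrt (4 * μ - 1) : ℝ) : ℂ) ^ 2 = 4 * μ - 1 := by exact_mod_cast h1
    push_cast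
    linear_combination (1 / 4) * h2 -
      (1 / 4) * ((Real.sqrt (4 * μ - 1) : ℝ) : ℂ) ^ 2 * Complex.I_sq

/-- `e₊` and `e₋` are, up to the shift `s = 1 + t`, solutions of the Klein–Gordon equation. -/
lemma exists_isKGSolution_ePlus_eMinus {μ r : ℝ} (hμ : 0 ≤ μ) (hr : 0 < r) :
    ∃ w w' z z' : ℝ → ℂ, IsKGSolution μ r w w' ∧ IsKGSolution μ r z z' ∧
      (∀ t, ePlus (nuOf μ) r t = w (1 + t)) ∧ (∀ t, eMinus (nuOf μ) r t = z (1 + t)) ∧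
      (∀ t, 0 ≤ t → ePlusDot (nuOf μ) r t = w' (1 + t)) ∧
      (∀ t, 0 ≤ t → eMinusDot (nuOf μ) r t = z' (1 + t)) := by
  set ν := nuOf μ with hν
  have h0 : 0 ≤ ν.re := nuOf_re_nonneg μ
  have h1 : ν.re ≤ 1 / 2 := nuOf_re_le hμ
  have h2 := nuOf_mul_eq μ
  rw [← hν] at h2
  obtain ⟨f', hf⟩ := exists_isKGSolution_sqrt_mul_besselJ (ν := ν) (by linarith) h2
  obtain ⟨k', hk⟩ := exists_isKGSolution_sqrt_mul_besselJ (ν := -ν) (m := μ)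
    (by rw [Complex.neg_re]; linarith) (by rw [← h2]; ring)
  have hw := hf.comp_mul hr
  have hz := hw.linear_comb (hk.comp_mul hr) (Complex.cos (ν * (π : ℂ)) / Complex.sin (ν * (π : ℂ)))
    (-1 / Complex.sin (ν * (π : ℂ)))
  have ew : ∀ t, ePlus ν r t = (fun s => (Real.sqrt (s * r) : ℂ) * besselJ ν (s * r)) (1 + t) :=
    fun t => rfl
  have ez : ∀ t, eMinus ν r t = (fun s => Complex.cos (ν * (π : ℂ)) / Complex.sin (ν * (π : ℂ)) *
      ((Real.sqrt (s * r) : ℂ) * besselJ ν (s * r)) + -1 / Complex.sin (ν * (π : ℂ)) *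
      ((Real.sqrt (s * r) : ℂ) * besselJ (-ν) (s * r))) (1 + t) := by
    intro t
    simp only [eMinus, besselY]
    ring
  refine ⟨_, _, _, _, hw, hz, ew, ez, fun t ht => ?_, fun t ht => ?_⟩
  · rw [ePlusDot, funext ew]
    exact ((hw (1 + t) (by linarith)).1.comp_const_add 1 t).deriv
  · rw [eMinusDot, funext ez]
    exact ((hz (1 + t) (by linarith)).1.comp_const_add 1 t).deriv

lemma min_div_rpow_le {p r s₀ s : ℝ} (hp : 0 ≤ p) (hr : 0 < r) (hs₀ : 0 < s₀) (hs : 0 < s) :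
    (min s r⁻¹ / s₀) ^ p ≤ r ^ (-p) * s₀ ^ (-p) ∧ (min s r⁻¹ / s₀) ^ p ≤ s ^ p * s₀ ^ (-p) := by
  have hmin : 0 < min s r⁻¹ := lt_min hs (inv_pos.2 hr)
  rw [Real.div_rpow hmin.le hs₀.le, Real.rpow_neg hr.le, ← Real.inv_rpow hr.le,
    Real.rpow_neg hs₀.le, ← div_eq_mul_inv, ← div_eq_mul_inv]
  constructor
  · gcongr
    exact min_le_right _ _
  · gcongr
    exact min_le_left _ _

lemma position_multiplier_bounds {C p r s₀ s x : ℝ} (hC : 0 ≤ C) (hp : 0 ≤ p) (hr : 0 < r)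
    (hs₀ : 1 ≤ s₀) (hs : s₀ ≤ s) (hhigh : 1 ≤ r * s₀ → x ≤ C)
    (hlow : r * s₀ ≤ 1 → x ≤ C * (min s r⁻¹ / s₀) ^ p) :
    x ≤ C * (1 + r ^ (-p)) ∧ x ≤ C * s ^ p * s₀ ^ (-p) := by
  have h0 : 0 < s₀ := by linarith
  have h1 : 0 < s := by linarith
  have hrp : 0 < r ^ (-p) := Real.rpow_pos_of_pos hr _
  have hsp : 0 < s₀ ^ (-p) := Real.rpow_pos_of_pos h0 _
  rcases le_total 1 (r * s₀) with h | h
  · have hx := hhigh h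
    refine ⟨hx.trans (le_mul_of_one_le_right hC (by linarith)), hx.trans ?_⟩
    rw [mul_assoc]
    refine le_mul_of_one_le_right hC ?_
    calc (1 : ℝ) = s₀ ^ p * s₀ ^ (-p) := by rw [← Real.rpow_add h0]; simp
      _ ≤ s ^ p * s₀ ^ (-p) := by gcongr
  · have hx := hlow h
    obtain ⟨m1, m2⟩ := min_div_rpow_le hp hr h0 h1
    refine ⟨hx.trans ?_, hx.trans ?_⟩
    · have h2 : s₀ ^ (-p) ≤ 1 := Real.rpow_le_one_of_one_le_of_nonpos hs₀ (by linarith)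
      refine mul_le_mul_of_nonneg_left (m1.trans ?_) hC
      nlinarith
    · rw [mul_assoc]
      exact mul_le_mul_of_nonneg_left m2 hC

lemma velocity_multiplier_bounds {C p r s₀ s x : ℝ} (hC : 0 ≤ C) (hp : 0 ≤ p) (hr : 0 < r)
    (hs₀ : 0 < s₀) (hs : s₀ ≤ s) (hhigh : 1 ≤ r * s₀ → x ≤ C * r⁻¹)
    (hlow : r * s₀ ≤ 1 → x ≤ C * (min s r⁻¹ / s₀) ^ p * s₀) :
    x ≤ C * (r⁻¹ + s₀ ^ (1 - p) * r ^ (-p)) ∧ x ≤ C * s ^ p * s₀ ^ (1 - p) := by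
  have h1 : 0 < s := by linarith
  have hrp : 0 < r ^ (-p) := Real.rpow_pos_of_pos hr _
  have hsp : 0 < s₀ ^ (1 - p) := Real.rpow_pos_of_pos hs₀ _
  have hri : 0 < r⁻¹ := inv_pos.2 hr
  have hsplit : s₀ ^ (1 - p) = s₀ ^ (-p) * s₀ := by
    rw [sub_eq_neg_add, Real.rpow_add_one hs₀.ne']
  rcases le_total 1 (r * s₀) with h | h
  · have hx := hhigh h
    refine ⟨hx.trans (mul_le_mul_of_nonneg_left ?_ hC), hx.trans ?_⟩
    · have : 0 < s₀ ^ (1 - p) * r ^ (-p) := by positivity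
      linarith
    · rw [mul_assoc]
      refine mul_le_mul_of_nonneg_left ?_ hC
      calc r⁻¹ ≤ s₀ := by rwa [inv_le_iff_one_le_mul₀' hr]
        _ = s₀ ^ p * s₀ ^ (1 - p) := by rw [← Real.rpow_add hs₀]; simp
        _ ≤ s ^ p * s₀ ^ (1 - p) := by gcongr
  · have hx := hlow h
    obtain ⟨m1, m2⟩ := min_div_rpow_le hp hr hs₀ h1
    rw [hsplit]
    refine ⟨hx.trans ?_, hx.trans ?_⟩
    · rw [mul_assoc]
      refine mul_le_mul_of_nonneg_left ?_ hC
      calc _ ≤ r ^ (-p) * s₀ ^ (-p) * s₀ := by gcongr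
        _ = s₀ ^ (-p) * s₀ * r ^ (-p) := by ring
        _ ≤ _ := by linarith
    · rw [mul_assoc, mul_assoc]
      refine mul_le_mul_of_nonneg_left ?_ hC
      rw [← mul_assoc]
      gcongr

/-- for `μ ≥ 0`, `μ ≠ 1/4`, uniform multiplier bounds for `E₀, E₁`
for all `t ≥ t₀ ≥ 0` and `ξ ≠ 0`. -/
theorem stmt10 (μ : ℝ) (hμ : 0 ≤ μ) (hμ' : μ ≠ 1 / 4) (d : ℕ) (hd : 1 ≤ d) :
    ∃ C > (0 : ℝ), ∀ t t₀ : ℝ, 0 ≤ t₀ → t₀ ≤ t →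
      ∀ ξ : EuclideanSpace ℝ (Fin d), ξ ≠ 0 →
        ‖E0 (nuOf μ) ‖ξ‖ t t₀‖ ≤ C * (1 + ‖ξ‖ ^ (-(1 / 2) - (nuOf μ).re)) ∧
        ‖E0 (nuOf μ) ‖ξ‖ t t₀‖ ≤
          C * (1 + t) ^ (1 / 2 + (nuOf μ).re) * (1 + t₀) ^ (-(1 / 2) - (nuOf μ).re) ∧
        ‖E1 (nuOf μ) ‖ξ‖ t t₀‖ ≤
          C * (‖ξ‖⁻¹ + (1 + t₀) ^ (1 / 2 - (nuOf μ).re) * ‖ξ‖ ^ (-(1 / 2) - (nuOf μ).re)) ∧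
        ‖E1 (nuOf μ) ‖ξ‖ t t₀‖ ≤
          C * (1 + t) ^ (1 / 2 + (nuOf μ).re) * (1 + t₀) ^ (1 / 2 - (nuOf μ).re) := by
  set ν := nuOf μ with hν
  have hν0 : 0 ≤ ν.re := nuOf_re_nonneg μ
  have hne : (1 / 2 + ν : ℂ) ≠ 1 / 2 - ν := by
    intro h
    have h2 : 2 * ν = 0 := by linear_combination h
    exact nuOf_ne_zero hμ' ((mul_eq_zero.1 h2).resolve_left two_ne_zero)
  have hre : (1 / 2 + ν : ℂ).re = 1 / 2 + ν.re := by simp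
  obtain ⟨C, hC, hbound⟩ := exists_uniform_bound hμ (a := 1 / 2 + ν) (b := 1 / 2 - ν)
    (by ring) (nuOf_mul_eq μ) hne (by rw [hre]; simp; linarith)
  rw [hre] at hbound
  refine ⟨C, hC, fun t t₀ ht₀ ht ξ hξ => ?_⟩
  have hr : 0 < ‖ξ‖ := norm_pos_iff.2 hξ
  set r := ‖ξ‖ with hrdef
  obtain ⟨w, w', z, z', hw, hz, ew, ez, ew', ez'⟩ := exists_isKGSolution_ePlus_eMinus hμ hr
  rw [← hν] at ew ez ew' ez'
  have hs₀ : 1 ≤ 1 + t₀ := by linarith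
  have hs₀' : 0 < 1 + t₀ := by linarith
  have hs : 1 + t₀ ≤ 1 + t := by linarith
  have hp : 0 ≤ 1 / 2 + ν.re := by linarith
  have e1 : -(1 / 2) - ν.re = -(1 / 2 + ν.re) := by ring
  have e2 : 1 / 2 - ν.re = 1 - (1 / 2 + ν.re) := by ring
  rw [e1, e2, ← and_assoc]
  simp only [E0, E1, ew, ez, ew' t₀ ht₀, ez' t₀ ht₀]
  set s₀ := 1 + t₀
  set s := 1 + t
  set D := w s₀ * z' s₀ - w' s₀ * z s₀ with hD
  have hrat : 0 ≤ min s r⁻¹ / s₀ :=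
    div_nonneg (le_min (by linarith) (inv_pos.2 hr).le) hs₀'.le
  have hratp : 0 ≤ C * (min s r⁻¹ / s₀) ^ (1 / 2 + ν.re) :=
    mul_nonneg hC.le (Real.rpow_nonneg hrat _)
  rcases eq_or_ne D 0 with hD0 | hD0
  · rw [hD0]
    simp only [div_zero, norm_zero]
    exact ⟨position_multiplier_bounds hC.le hp hr hs₀ hs (fun _ => hC.le) (fun _ => hratp),
      velocity_multiplier_bounds hC.le hp hr hs₀' hs (fun _ => by positivity)
        (fun _ => by positivity)⟩
  · constructor
    · obtain ⟨b1, b2⟩ := hbound r _ _ hr (hw.linear_comb hz (z' s₀ / D) (-(w' s₀) / D))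
        s₀ s hs₀' hs
      have i0 : z' s₀ / D * w s₀ + -(w' s₀) / D * z s₀ = 1 := by
        rw [div_mul_eq_mul_div, div_mul_eq_mul_div, ← add_div, div_eq_one_iff_eq hD0, hD]
        ring
      have i1 : z' s₀ / D * w' s₀ + -(w' s₀) / D * z' s₀ = 0 := by ring
      have i2 : z' s₀ / D * w s + -(w' s₀) / D * z s = (w s * z' s₀ - w' s₀ * z s) / D := by ring
      simp only [i0, i1, i2, norm_one, norm_zero, mul_zero, add_zero, mul_one] at b1 b2
      exact position_multiplier_bounds hC.le hp hr hs₀ hs b1 b2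
    · obtain ⟨b1, b2⟩ := hbound r _ _ hr (hw.linear_comb hz (-(z s₀) / D) (w s₀ / D))
        s₀ s hs₀' hs
      have i0 : -(z s₀) / D * w s₀ + w s₀ / D * z s₀ = 0 := by ring
      have i1 : -(z s₀) / D * w' s₀ + w s₀ / D * z' s₀ = 1 := by
        rw [div_mul_eq_mul_div, div_mul_eq_mul_div, ← add_div, div_eq_one_iff_eq hD0, hD]
        ring
      have i2 : -(z s₀) / D * w s + w s₀ / D * z s = (w s₀ * z s - w s * z s₀) / D := by ring
      simp only [i0, i1, i2, norm_one, norm_zero, zero_add, mul_one] at b1 b2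
      exact velocity_multiplier_bounds hC.le hp hr hs₀' hs b1 b2

end
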